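/- Safety of paths in adapted CP-subnets: let (N,μ₀) be a perpetual free-choice system with regeneration cluster cl, let N̂ ⊆ N be a cl-adapted CP-subnet, and let μ be any reachable marking of (N,μ₀). Then every path δ contained in N̂ has token count ‖μ‖_δ ≤ 1. -/

import Mathlib

open Classical

/-- A (finite, bipartite) Petri *net*: disjoint finite sets of places and
transitions, and an edge relation running only between places and transitions. -/
structure Net (α : Type*) where
  places : Finset α
  transitions : Finset α
  F : α → α → Prop
  disj : Disjoint places transitions
  edges : ∀ x y, F x y →
    (x ∈ places ∧ y ∈ transitions) ∨ (x ∈ transitions ∧ y ∈ places)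

namespace Net

variable {α : Type*} [DecidableEq α]

/-- The nodes of a net. -/
def nodes (N : Net α) : Finset α := N.places ∪ N.transitions

/-- Pre-set of a node. -/
def pre (N : Net α) (x : α) : Set α := {y | N.F y x}

/-- Post-set of a node. -/
def post (N : Net α) (x : α) : Set α := {y | N.F x y}

/-- A transition `t` is enabled at a marking `μ` if every pre-place is marked. -/
def Enabled (N : Net α) (μ : α → ℕ) (t : α) : Prop :=
  t ∈ N.transitions ∧ ∀ p, N.F p t → 1 ≤ μ p

/-- Firing a transition: remove one token from each pre-place,
add one token at each post-place. -/
noncomputable def fire (N : Net α) (t : α) (μ : α → ℕ) : α → ℕ :=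
  fun p => μ p - (if N.F p t then 1 else 0) + (if N.F t p then 1 else 0)

/-- `FireSeq N μ σ ν`: the occurrence sequence `σ` is enabled at `μ` and
firing it successively leads from `μ` to `ν`. -/
inductive FireSeq (N : Net α) : (α → ℕ) → List α → (α → ℕ) → Prop
  | nil (μ : α → ℕ) : FireSeq N μ [] μ
  | cons {μ ν : α → ℕ} {t : α} {σ : List α} :
      N.Enabled μ t → FireSeq N (N.fire t μ) σ ν → FireSeq N μ (t :: σ) ν

/-- Reachability of markings. -/
def Reach (N : Net α) (μ ν : α → ℕ) : Prop := ∃ σ : List α, N.FireSeq μ σ ν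

/-- The set of transitions enabled at `μ`. -/
def en (N : Net α) (μ : α → ℕ) : Set α := {t | N.Enabled μ t}

/-- Equality of markings (as maps on the places of the net). -/
def MarkingEq (N : Net α) (μ ν : α → ℕ) : Prop := ∀ p ∈ N.places, μ p = ν p

/-- Liveness of a Petri net `(N, μ₀)`. -/
def Live (N : Net α) (μ₀ : α → ℕ) : Prop :=
  ∀ t ∈ N.transitions, ∀ μ, N.Reach μ₀ μ → ∃ ν, N.Reach μ ν ∧ N.Enabled ν t

/-- Boundedness of a Petri net `(N, μ₀)`. -/
def Bounded (N : Net α) (μ₀ : α → ℕ) : Prop :=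
  ∃ K : ℕ, ∀ μ, N.Reach μ₀ μ → ∀ p ∈ N.places, μ p ≤ K

/-- A net is well-formed if it carries a live and bounded marking. -/
def WellFormed (N : Net α) : Prop := ∃ μ₀ : α → ℕ, N.Live μ₀ ∧ N.Bounded μ₀

/-- Free-choice net: `(p,t) ∈ F` implies `•t × p• ⊆ F`. -/
def FreeChoice (N : Net α) : Prop :=
  ∀ p ∈ N.places, ∀ t, N.F p t → ∀ p', N.F p' t → ∀ t', N.F p t' → N.F p' t'

/-- T-net: every place has exactly one pre-transition and one post-transition. -/
def IsTNet (N : Net α) : Prop :=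
  ∀ p ∈ N.places, (∃! t, N.F t p) ∧ (∃! t, N.F p t)

/-- A set of nodes is cluster-closed if with each place it contains the
post-set of the place and with each transition the pre-set of the transition. -/
def ClusterClosed (N : Net α) (S : Set α) : Prop :=
  (∀ p ∈ S, p ∈ N.places → ∀ t, N.F p t → t ∈ S) ∧
  (∀ t ∈ S, t ∈ N.transitions → ∀ p, N.F p t → p ∈ S)

/-- The cluster of a node: the smallest cluster-closed set of nodes containing it. -/
def clusterOf (N : Net α) (x : α) : Set α :=
  ⋂₀ {S : Set α | x ∈ S ∧ N.ClusterClosed S}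

/-- `cl` is a cluster of `N` if it is the cluster of some node. -/
def IsCluster (N : Net α) (cl : Set α) : Prop :=
  ∃ x ∈ N.nodes, cl = N.clusterOf x

/-- The marking `μ_cl` marking exactly the places of the cluster `cl`, once. -/
noncomputable def clusterMarking (N : Net α) (cl : Set α) : α → ℕ :=
  fun p => if p ∈ cl ∧ p ∈ N.places then 1 else 0

/-- `μh` is a home marking of `(N, μ₀)`: reachable from every reachable marking. -/
def IsHomeMarking (N : Net α) (μ₀ μh : α → ℕ) : Prop :=
  ∀ μ, N.Reach μ₀ μ → ∃ ν, N.Reach μ ν ∧ N.MarkingEq ν μh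

/-- `(N, μ₀)` is perpetual with regeneration cluster `cl`: live, bounded, and
`μ_cl` is a home marking for the cluster `cl`. -/
def Perpetual (N : Net α) (μ₀ : α → ℕ) (cl : Set α) : Prop :=
  N.Live μ₀ ∧ N.Bounded μ₀ ∧ N.IsCluster cl ∧
    N.IsHomeMarking μ₀ (N.clusterMarking cl)

/-- Lucency: enabling-equivalent reachable markings are equal. -/
def Lucent (N : Net α) (μ₀ : α → ℕ) : Prop :=
  ∀ μ₁ μ₂, N.Reach μ₀ μ₁ → N.Reach μ₀ μ₂ → N.en μ₁ = N.en μ₂ → N.MarkingEq μ₁ μ₂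

/-- A path of the net: a nonempty sequence of nodes along edges. -/
def IsPath (N : Net α) (δ : List α) : Prop :=
  δ ≠ [] ∧ (∀ x ∈ δ, x ∈ N.nodes) ∧ δ.Chain' N.F

/-- A circuit: a path whose last node is connected back to its first node. -/
def IsCircuit (N : Net α) (δ : List α) : Prop :=
  N.IsPath δ ∧ ∃ h : δ ≠ [], N.F (δ.getLast h) (δ.head h)

/-- Token count of a set of nodes: total number of tokens on its places. -/
def tokenCount (N : Net α) (μ : α → ℕ) (X : Finset α) : ℕ :=
  ∑ p ∈ X ∩ N.places, μ p

/-- The set `S` of nodes is strongly connected (in the induced subnet). -/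
def StronglyConnectedOn (N : Net α) (S : Finset α) : Prop :=
  ∀ x ∈ S, ∀ y ∈ S,
    Relation.ReflTransGen (fun a b => a ∈ S ∧ b ∈ S ∧ N.F a b) x y

/-- The set `S` of nodes is weakly connected (in the induced subnet). -/
def WeaklyConnectedOn (N : Net α) (S : Finset α) : Prop :=
  ∀ x ∈ S, ∀ y ∈ S,
    Relation.ReflTransGen (fun a b => a ∈ S ∧ b ∈ S ∧ (N.F a b ∨ N.F b a)) x y

/-- The (full) subnet spanned by `S` is transition-bordered: every place of `S`
has all its neighbours inside `S`. -/
def TransitionBordered (N : Net α) (S : Finset α) : Prop :=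
  ∀ p ∈ S, p ∈ N.places → ∀ y, (N.F y p ∨ N.F p y) → y ∈ S

/-- The full subnet spanned by `S` is a T-net: each place of `S` has exactly one
pre-transition and one post-transition inside `S`. -/
def TNetOn (N : Net α) (S : Finset α) : Prop :=
  ∀ p ∈ S, p ∈ N.places →
    (∃! t, t ∈ S ∧ N.F t p) ∧ (∃! t, t ∈ S ∧ N.F p t)

/-- `S` spans a CP-subnet of `N`: nonempty, weakly connected, transition-bordered,
a T-net, and the complement contains a transition and is strongly connected. -/
def IsCPSubnet (N : Net α) (S : Finset α) : Prop :=
  S.Nonempty ∧ S ⊆ N.nodes ∧ N.WeaklyConnectedOn S ∧ N.TransitionBordered S ∧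
  N.TNetOn S ∧ ((N.nodes \ S) ∩ N.transitions).Nonempty ∧
  N.StronglyConnectedOn (N.nodes \ S)

/-- The full subnet of `N` spanned by the node set `S`, as a net. -/
def restrict (N : Net α) (S : Finset α) : Net α where
  places := N.places ∩ S
  transitions := N.transitions ∩ S
  F := fun x y => x ∈ S ∧ y ∈ S ∧ N.F x y
  disj := N.disj.mono Finset.inter_subset_left Finset.inter_subset_left
  edges := by
    rintro x y ⟨hx, hy, hF⟩
    rcases N.edges x y hF with ⟨h1, h2⟩ | ⟨h1, h2⟩
    · exact Or.inl ⟨Finset.mem_inter.mpr ⟨h1, hx⟩, Finset.mem_inter.mpr ⟨h2, hy⟩⟩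
    · exact Or.inr ⟨Finset.mem_inter.mpr ⟨h1, hx⟩, Finset.mem_inter.mpr ⟨h2, hy⟩⟩

/-- A CP-exhaustion: a family of pairwise disjoint CP-subnets whose complement
is a strongly connected T-net. -/
def IsCPExhaustion (N : Net α) {n : ℕ}
    (Nhat : Fin n → Finset α) : Prop :=
  (∀ i, N.IsCPSubnet (Nhat i)) ∧
  (∀ i j, i ≠ j → Disjoint (Nhat i) (Nhat j)) ∧
  N.StronglyConnectedOn (N.nodes \ Finset.univ.biUnion Nhat) ∧
  N.TNetOn (N.nodes \ Finset.univ.biUnion Nhat)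

/-- `t` is a way-in transition of the subnet spanned by `S`: a transition of `S`
with a pre-place outside `S`. -/
def IsWayIn (N : Net α) (S : Finset α) (t : α) : Prop :=
  t ∈ S ∧ t ∈ N.transitions ∧ ∃ p ∈ N.places, p ∉ S ∧ N.F p t

/-- A shutdown sequence for the subnet spanned by `S` (with way-in transition
`tin`) at a marking `μ`: an occurrence sequence enabled at `μ` using only
transitions of `S` other than `tin`, after which no transition of `S` other
than (possibly) `tin` is enabled. -/
def IsShutdownSeq (N : Net α) (S : Finset α) (tin : α)
    (μ : α → ℕ) (σ : List α) (μsd : α → ℕ) : Prop :=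
  N.FireSeq μ σ μsd ∧
  (∀ t ∈ σ, t ∈ S ∧ t ∈ N.transitions ∧ t ≠ tin) ∧
  (∀ t ∈ S, t ∈ N.transitions → t ≠ tin → ¬ N.Enabled μsd t)

/-- `C` spans a P-component of `N`: nonempty, strongly connected, inside `C`
every transition has exactly one pre-place and one post-place, and every place
of `C` has all its neighbours inside `C`. -/
def IsPComponent (N : Net α) (C : Finset α) : Prop :=
  C.Nonempty ∧ C ⊆ N.nodes ∧ N.StronglyConnectedOn C ∧
  (∀ t ∈ C, t ∈ N.transitions →
    (∃! p, p ∈ C ∧ N.F p t) ∧ (∃! p, p ∈ C ∧ N.F t p)) ∧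
  (∀ p ∈ C, p ∈ N.places → ∀ y, (N.F y p ∨ N.F p y) → y ∈ C)

end Net

namespace Net

variable {α : Type*} {N : Net α} {μ ν M : α → ℕ} {t u : α} {σ : List α}

theorem mem_transitions_of_edge {p : α} (hp : p ∈ N.places) (h : N.F p t) :
    t ∈ N.transitions := by
  rcases N.edges _ _ h with hpt | htp
  · exact hpt.2
  · exact absurd htp.1 (Finset.disjoint_left.mp N.disj hp)

theorem mem_transitions_of_edge' {p : α} (hp : p ∈ N.places) (h : N.F t p) :
    t ∈ N.transitions := by
  rcases N.edges _ _ h with hpt | htp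
  · exact absurd hp (Finset.disjoint_right.mp N.disj hpt.2)
  · exact htp.1

theorem mem_places_of_edge {p : α} (ht : t ∈ N.transitions) (h : N.F p t) :
    p ∈ N.places := by
  rcases N.edges _ _ h with hpt | htp
  · exact hpt.1
  · exact absurd ht (Finset.disjoint_left.mp N.disj htp.2)

theorem mem_places_of_edge' {p : α} (ht : t ∈ N.transitions) (h : N.F t p) :
    p ∈ N.places := by
  rcases N.edges _ _ h with hpt | htp
  · exact absurd ht (Finset.disjoint_left.mp N.disj hpt.1)
  · exact htp.2

/-- In a free-choice net, transitions sharing a pre-place have the same pre-set. -/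
theorem FreeChoice.pre_eq (hfc : N.FreeChoice) {p : α} (hp : p ∈ N.places)
    (h : N.F p t) (h' : N.F p u) : N.pre t = N.pre u := by
  ext q
  exact ⟨fun hq => hfc p hp t h q hq u h', fun hq => hfc p hp u h' q hq t h⟩

theorem Enabled.of_pre_eq (h : N.Enabled μ t) (hu : u ∈ N.transitions)
    (htu : N.pre t = N.pre u) : N.Enabled μ u :=
  ⟨hu, fun p hp => h.2 p (show p ∈ N.pre t from htu ▸ hp)⟩

theorem Enabled.cast_fire (h : N.Enabled μ t) (p : α) :
    (N.fire t μ p : ℤ) =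
      μ p + ((if N.F t p then 1 else 0) - (if N.F p t then 1 else 0)) := by
  have := h.2 p
  unfold fire
  split_ifs with h1 h2 h2
  · have := this h1
    push_cast [Nat.cast_sub this]
    ring
  · have := this h1
    push_cast [Nat.cast_sub this]
    ring
  all_goals simp

theorem FireSeq.append {τ : List α} {ξ : α → ℕ} (h : N.FireSeq μ σ ν)
    (h' : N.FireSeq ν τ ξ) : N.FireSeq μ (σ ++ τ) ξ := by
  induction h with
  | nil => exact h'
  | cons he _ ih => exact .cons he (ih h')

theorem Reach.refl (μ : α → ℕ) : N.Reach μ μ := ⟨[], .nil μ⟩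

theorem Reach.trans {ξ : α → ℕ} (h : N.Reach μ ν) (h' : N.Reach ν ξ) : N.Reach μ ξ := by
  obtain ⟨σ, h⟩ := h
  obtain ⟨τ, h'⟩ := h'
  exact ⟨_, h.append h'⟩

theorem Reach.fire (h : N.Reach μ ν) (he : N.Enabled ν t) : N.Reach μ (N.fire t ν) :=
  h.trans ⟨[t], .cons he (.nil _)⟩

/-- Values of a marking outside the places never change. -/
theorem Reach.eq_of_notMem_places (h : N.Reach μ ν) {x : α} (hx : x ∉ N.places) :
    ν x = μ x := by
  obtain ⟨σ, h⟩ := h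
  induction h with
  | nil => rfl
  | cons he _ ih =>
    have h1 := fun h => hx (mem_places_of_edge he.1 h)
    have h2 := fun h => hx (mem_places_of_edge' he.1 h)
    rw [ih, Net.fire, if_neg h1, if_neg h2]
    rfl

theorem Live.of_reach (h : N.Live μ) (hr : N.Reach μ ν) : N.Live ν :=
  fun t ht _ hξ => h t ht _ (hr.trans hξ)

/-- The token gain of a set of places when a transition fires. -/
noncomputable def gain (N : Net α) (Q : Finset α) (t : α) : ℤ :=
  ∑ p ∈ Q, ((if N.F t p then 1 else 0) - (if N.F p t then 1 else 0))

theorem FireSeq.sum_eq (h : N.FireSeq μ σ ν) (Q : Finset α) :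
    ∑ p ∈ Q, (ν p : ℤ) = ∑ p ∈ Q, (μ p : ℤ) + (σ.map (N.gain Q)).sum := by
  induction h with
  | nil => simp
  | cons he _ ih =>
    rw [ih, Finset.sum_congr rfl fun p _ => he.cast_fire p, Finset.sum_add_distrib,
      List.map_cons, List.sum_cons, gain, add_assoc]

theorem FireSeq.mem_transitions (h : N.FireSeq μ σ ν) : ∀ t ∈ σ, t ∈ N.transitions := by
  induction h with
  | nil => simp
  | cons he _ ih => simpa using ⟨he.1, ih⟩

/-- A live system that returns to its marking fires every transition on some cycle. -/
theorem exists_cycle (hlive : N.Live M) (hret : ∀ μ, N.Reach M μ → N.Reach μ M)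
    (ht : t ∈ N.transitions) : ∃ σ, N.FireSeq M σ M ∧ t ∈ σ := by
  obtain ⟨ν, ⟨σ, hσ⟩, he⟩ := hlive t ht M (Reach.refl M)
  obtain ⟨τ, hτ⟩ := hret _ (Reach.fire ⟨σ, hσ⟩ he)
  exact ⟨_, hσ.append (.cons he hτ), by simp⟩

/-- A set of places that no transition decreases is conserved. -/
theorem gain_eq_zero (hlive : N.Live M) (hret : ∀ μ, N.Reach M μ → N.Reach μ M)
    {Q : Finset α} (hQ : ∀ t ∈ N.transitions, 0 ≤ N.gain Q t) :
    ∀ t ∈ N.transitions, N.gain Q t = 0 := by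
  intro t ht
  obtain ⟨σ, hσ, hmem⟩ := exists_cycle hlive hret ht
  have h0 : (σ.map (N.gain Q)).sum = 0 := by linarith [hσ.sum_eq Q]
  refine le_antisymm ?_ (hQ t ht)
  rw [← h0]
  refine List.single_le_sum ?_ _ (List.mem_map_of_mem hmem)
  simpa using fun u hu => hQ u (hσ.mem_transitions u hu)

theorem Reach.sum_eq_of_gain_eq_zero (h : N.Reach μ ν) {Q : Finset α}
    (hQ : ∀ t ∈ N.transitions, N.gain Q t = 0) : ∑ p ∈ Q, ν p = ∑ p ∈ Q, μ p := by
  obtain ⟨σ, hσ⟩ := h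
  have h0 : (σ.map (N.gain Q)).sum = 0 := by
    refine List.sum_eq_zero ?_
    simpa using fun u hu => hQ u (hσ.mem_transitions u hu)
  have := hσ.sum_eq Q
  rw [h0, add_zero] at this
  exact_mod_cast this

/-- Skipping the firings of a transition without post-places keeps its input tokens. -/
theorem FireSeq.exists_skip (hsink : ∀ p, ¬ N.F t p) (h : N.FireSeq μ σ ν) (D : α → ℕ) :
    N.Reach (fun p => μ p + D p)
      (fun p => ν p + D p + σ.count t * (if N.F p t then 1 else 0)) := by
  induction h generalizing D with
  | nil => simpa using Reach.refl _
  | @cons μ ν s σ he _ ih =>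
    by_cases hst : s = t
    · subst hst
      convert ih (fun p => D p + if N.F p s then 1 else 0) using 1
      · funext p
        have := he.2 p
        unfold Net.fire
        rw [if_neg (hsink p)]
        split_ifs with h
        · have := this h
          omega
        · omega
      · funext p
        rw [List.count_cons_self]
        ring
    · have he' : N.Enabled (fun p => μ p + D p) s :=
        ⟨he.1, fun p hp => (he.2 p hp).trans (Nat.le_add_right _ _)⟩
      refine ((Reach.refl _).fire he').trans ?_
      convert ih D using 1
      · funext p
        have := he.2 p
        simp only [Net.fire]
        split_ifs with h1 <;> first | (have := this h1; omega) | omega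
      · funext p
        rw [List.count_cons_of_ne hst]

/-- In a live and bounded system with recurrent marking, a transition consuming a token
also produces one. -/
theorem exists_post (hlive : N.Live M) (hret : ∀ μ, N.Reach M μ → N.Reach μ M)
    (hb : N.Bounded M) (ht : t ∈ N.transitions) {p : α} (hp : N.F p t) : ∃ q, N.F t q := by
  by_contra! hsink
  obtain ⟨σ, hσ, hmem⟩ := exists_cycle hlive hret ht
  obtain ⟨K, hK⟩ := hb
  have key (n : ℕ) : N.Reach M
      (fun q => M q + n * (σ.count t * (if N.F q t then 1 else 0))) := by
    induction n with
    | zero => simpa using Reach.refl M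
    | succ n ih =>
      refine ih.trans ?_
      convert hσ.exists_skip hsink (fun q => n * (σ.count t * (if N.F q t then 1 else 0)))
        using 1
      funext q
      ring
  have h1 := hK _ (key (K + 1)) p (mem_places_of_edge ht hp)
  have h2 : 0 < σ.count t := List.count_pos_iff.mpr hmem
  simp only [if_pos hp] at h1
  nlinarith

/-- In a bounded system a transition producing a token also consumes one. -/
theorem exists_pre (hb : N.Bounded M) (ht : t ∈ N.transitions) {q : α} (hq : N.F t q) :
    ∃ p, N.F p t := by
  by_contra! hsource
  obtain ⟨K, hK⟩ := hb
  have key (n : ℕ) : N.Reach M (fun p => M p + n * (if N.F t p then 1 else 0)) := by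
    induction n with
    | zero => simpa using Reach.refl M
    | succ n ih =>
      convert ih.fire ⟨ht, fun p hp => absurd hp (hsource p)⟩ using 1
      funext p
      rw [Net.fire, if_neg (hsource p)]
      rw [Nat.sub_zero]
      ring
  have := hK _ (key (K + 1)) q (mem_places_of_edge' ht hq)
  simp only [if_pos hq] at this
  omega

/-- Every transition feeding `R` also consumes from `R`. -/
def IsSiphon (N : Net α) (R : Finset α) : Prop :=
  R ⊆ N.places ∧ ∀ p ∈ R, ∀ t, N.F t p → ∃ q ∈ R, N.F q t

/-- Every transition consuming from `Q` also feeds `Q`. -/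
def IsTrap (N : Net α) (Q : Finset α) : Prop :=
  ∀ p ∈ Q, ∀ t, N.F p t → ∃ q ∈ Q, N.F t q

/-- A set of places contains a trap outside of which tokens can be routed so as to
decrease a weight. -/
theorem exists_trap_weight (N : Net α) (R : Finset α) :
    ∃ Q ⊆ R, N.IsTrap Q ∧ ∃ w : α → ℕ, ∀ p ∈ R \ Q, ∃ t, N.F p t ∧ (∀ q ∈ Q, ¬ N.F t q) ∧
      ∑ q ∈ R \ Q with N.F t q, w q < w p := by
  induction R using Finset.strongInduction with
  | H R ih =>
    by_cases htrap : N.IsTrap R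
    · exact ⟨R, subset_rfl, htrap, 0, by simp⟩
    simp only [IsTrap] at htrap
    push Not at htrap
    obtain ⟨p, hp, t, hpt, hno⟩ := htrap
    obtain ⟨Q, hQ, hQt, w, hw⟩ := ih _ (Finset.erase_ssubset hp)
    have hpQ : p ∉ Q := fun h => by simpa using hQ h
    refine ⟨Q, hQ.trans (Finset.erase_subset _ _), hQt,
      fun x => if x = p then 1 else 2 * w x, fun q hq => ?_⟩
    by_cases hqp : q = p
    · subst hqp
      refine ⟨t, hpt, fun x hx => hno x (Finset.erase_subset _ _ (hQ hx)), ?_⟩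
      rw [Finset.filter_false_of_mem fun x hx => hno x (Finset.mem_sdiff.mp hx).1]
      simp
    · obtain ⟨s, hqs, hsQ, hlt⟩ := hw q (by simp_all)
      refine ⟨s, hqs, hsQ, ?_⟩
      simp only [if_neg hqp]
      replace hlt : ∑ x ∈ (R.erase p \ Q).filter (N.F s), w x < w q := hlt
      have hsub : (R \ Q).filter (N.F s) ⊆ insert p ((R.erase p \ Q).filter (N.F s)) := by
        intro x hx
        by_cases hxp : x = p <;> simp_all
      calc _ ≤ ∑ x ∈ insert p ((R.erase p \ Q).filter (N.F s)),
              (if x = p then 1 else 2 * w x) := Finset.sum_le_sum_of_subset hsub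
        _ = 1 + ∑ x ∈ (R.erase p \ Q).filter (N.F s), (if x = p then 1 else 2 * w x) := by
            rw [Finset.sum_insert (by simp), if_pos rfl]
        _ = 1 + 2 * ∑ x ∈ (R.erase p \ Q).filter (N.F s), w x := by
            rw [Finset.mul_sum]
            congr 1
            refine Finset.sum_congr rfl fun x hx => if_neg ?_
            rintro rfl
            simp at hx
        _ < 2 * w q := by omega

/-- Before a transition consuming from a siphon fires, the siphon is untouched. -/
theorem FireSeq.exists_first_touch {R : Finset α} (hR : N.IsSiphon R)
    (h : N.FireSeq μ σ ν) (he : N.Enabled ν u) (hu : ∃ p ∈ R, N.F p u) :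
    ∃ ξ t, N.Reach μ ξ ∧ (∀ p ∈ R, ξ p = μ p) ∧ N.Enabled ξ t ∧ ∃ p ∈ R, N.F p t := by
  induction h with
  | nil μ => exact ⟨μ, u, Reach.refl μ, fun _ _ => rfl, he, hu⟩
  | @cons μ ν s σ hs _ ih =>
    by_cases hsR : ∃ p ∈ R, N.F p s
    · exact ⟨μ, s, Reach.refl μ, fun _ _ => rfl, hs, hsR⟩
    · obtain ⟨ξ, t, hr, hξ, ht⟩ := ih he
      refine ⟨ξ, t, ((Reach.refl μ).fire hs).trans hr, fun p hp => ?_, ht⟩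
      have h1 : ¬ N.F p s := fun h => hsR ⟨p, hp, h⟩
      have h2 : ¬ N.F s p := fun h => hsR (hR.2 p hp s h)
      rw [hξ p hp, Net.fire, if_neg h1, if_neg h2]
      rfl

/-- In a live free-choice system every siphon with a post-transition contains a
marked trap. -/
theorem exists_marked_trap (hfc : N.FreeChoice) (hlive : N.Live M) {R : Finset α}
    (hR : N.IsSiphon R) (hu : ∃ p ∈ R, N.F p u) :
    ∃ Q ⊆ R, N.IsTrap Q ∧ ∃ p ∈ Q, M p ≠ 0 := by
  obtain ⟨Q, hQR, hQ, w, hw⟩ := exists_trap_weight N R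
  refine ⟨Q, hQR, hQ, ?_⟩
  by_contra! hM
  have huT : u ∈ N.transitions := by
    obtain ⟨p, hp, h⟩ := hu
    exact mem_transitions_of_edge (hR.1 hp) h
  have key (n : ℕ) : ∀ μ, N.Reach M μ → (∀ p ∈ Q, μ p = 0) →
      ∑ p ∈ R \ Q, μ p * w p = n → False := by
    induction n using Nat.strong_induction_on with
    | _ n ih =>
      intro μ hr h0 hn
      obtain ⟨ν, ⟨σ, hσ⟩, he⟩ := hlive u huT μ hr
      obtain ⟨ξ, t, hξ, hξR, het, p, hp, hpt⟩ := hσ.exists_first_touch hR he hu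
      have hpQ : p ∉ Q := fun h => by
        have := het.2 p hpt
        rw [hξR p hp, h0 p h] at this
        omega
      have hpRQ : p ∈ R \ Q := Finset.mem_sdiff.mpr ⟨hp, hpQ⟩
      obtain ⟨s, hps, hsQ, hlt⟩ := hw p hpRQ
      have hs : N.Enabled ξ s := het.of_pre_eq
        (mem_transitions_of_edge (hR.1 hp) hps) (hfc.pre_eq (hR.1 hp) hpt hps)
      refine ih _ ?_ _ ((hr.trans hξ).fire hs) ?_ rfl
      · have hle (q : α) : (q ∈ R \ Q) → N.fire s ξ q * w q + (if q = p then w q else 0) ≤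
            ξ q * w q + (if N.F s q then w q else 0) := by
          intro _
          have := hs.2 q
          unfold Net.fire
          by_cases hqp : q = p
          · subst hqp
            obtain ⟨k, hk⟩ := Nat.exists_eq_add_of_le (this hps)
            rw [if_pos hps, if_pos rfl, hk]
            split_ifs <;> simp <;> nlinarith
          · rw [if_neg hqp]
            have h3 : ξ q - (if N.F q s then 1 else 0) ≤ ξ q := Nat.sub_le _ _
            have h4 := Nat.mul_le_mul_right (w q) h3
            split_ifs at h4 ⊢ <;> nlinarith
        have hsum := Finset.sum_le_sum hle
        rw [Finset.sum_add_distrib, Finset.sum_add_distrib, Finset.sum_ite_eq' (R \ Q) p,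
          if_pos hpRQ, ← Finset.sum_filter] at hsum
        have h5 : ∑ q ∈ R \ Q, ξ q * w q = n := by
          rw [← hn]
          exact Finset.sum_congr rfl fun q hq => by rw [hξR q (Finset.mem_sdiff.mp hq).1]
        omega
      · intro q hq
        rw [Net.fire, if_neg (hsQ q hq), hξR q (hQR hq), h0 q hq]
        simp
  exact key _ M (Reach.refl M) hM rfl

/-- The cluster of a transition with pre-place in a cluster covers that cluster. -/
theorem IsCluster.subset [DecidableEq α] (hfc : N.FreeChoice) {cl : Set α} (hcl : N.IsCluster cl) {p : α}
    (hp : p ∈ N.places) (hpcl : p ∈ cl) (hpt : N.F p t) :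
    cl ⊆ N.pre t ∪ {u | u ∈ N.transitions ∧ N.pre u = N.pre t} := by
  obtain ⟨x, -, rfl⟩ := hcl
  have htT := mem_transitions_of_edge hp hpt
  set C := N.pre t ∪ {u | u ∈ N.transitions ∧ N.pre u = N.pre t} with hC
  have hclosed : N.ClusterClosed C := by
    constructor
    · rintro q (hq | hq) hqP u hqu
      · exact Or.inr ⟨mem_transitions_of_edge hqP hqu, hfc.pre_eq hqP hqu hq⟩
      · exact absurd hq.1 (Finset.disjoint_left.mp N.disj hqP)
    · rintro u (hu | hu) huT q hqu
      · exact absurd huT (Finset.disjoint_left.mp N.disj (mem_places_of_edge htT hu))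
      · exact Or.inl (show q ∈ N.pre t from hu.2 ▸ hqu)
  have hcompl : N.ClusterClosed Cᶜ := by
    constructor
    · rintro q hq hqP u hqu (hu | hu)
      · exact absurd (mem_transitions_of_edge hqP hqu)
          (Finset.disjoint_left.mp N.disj (mem_places_of_edge htT hu))
      · exact hq (Or.inl (show q ∈ N.pre t from hu.2 ▸ hqu))
    · rintro u hu huT q hqu (hq | hq)
      · exact hu (Or.inr ⟨huT, hfc.pre_eq (mem_places_of_edge htT hq) hqu hq⟩)
      · exact absurd hq.1 (Finset.disjoint_left.mp N.disj (mem_places_of_edge huT hqu))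
  by_cases hx : x ∈ C
  · exact Set.sInter_subset_of_mem ⟨hx, hclosed⟩
  · exact absurd (Or.inl hpt) (Set.mem_sInter.mp hpcl Cᶜ ⟨hx, hcompl⟩)

/-- Inside an adapted CP-subnet there is no place of the cluster. -/
theorem IsCPSubnet.notMem_cluster [DecidableEq α] (hfc : N.FreeChoice) {cl : Set α} (hcl : N.IsCluster cl)
    {S : Finset α} (hS : N.IsCPSubnet S) (had : ¬ cl ⊆ (S : Set α)) {p : α}
    (hp : p ∈ N.places) (hpS : p ∈ S) : p ∉ cl := by
  intro hpcl
  obtain ⟨-, -, -, hbord, htnet, ⟨u, hu⟩, hsc⟩ := hS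
  obtain ⟨t, ⟨-, hpt⟩, -⟩ := (htnet p hpS hp).2
  obtain ⟨z, hz, hzS⟩ := Set.not_subset.mp had
  rcases hcl.subset hfc hp hpcl hpt hz with hzt | hzt
  · have hzP := mem_places_of_edge (mem_transitions_of_edge hp hpt) hzt
    rw [Finset.mem_inter] at hu
    have hzu := hsc z (Finset.mem_sdiff.mpr ⟨Finset.mem_union_left _ hzP, hzS⟩) u hu.1
    rcases hzu.cases_head with rfl | ⟨s, ⟨-, hs, hzs⟩, -⟩
    · exact Finset.disjoint_left.mp N.disj hzP hu.2
    · have hps : p ∈ N.pre s := hfc.pre_eq hzP hzt hzs ▸ hpt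
      exact (Finset.mem_sdiff.mp hs).2 (hbord p hpS hp s (Or.inr hps))
  · have : p ∈ N.pre z := hzt.2 ▸ hpt
    exact hzS (hbord p hpS hp z (Or.inr this))

/-- The edge relation of the full subnet spanned by `S`. -/
def EdgeIn (N : Net α) (S : Finset α) (a b : α) : Prop := a ∈ S ∧ b ∈ S ∧ N.F a b

/-- A CP-subnet whose places are unmarked in a live marking is acyclic. -/
theorem IsCPSubnet.acyclic [DecidableEq α] (hfc : N.FreeChoice) (hlive : N.Live M) {S : Finset α}
    (hS : N.IsCPSubnet S) (hM : ∀ p ∈ N.places, p ∈ S → M p = 0) (x : α) :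
    ¬ Relation.TransGen (N.EdgeIn S) x x := by
  obtain ⟨-, hSN, -, hbord, htnet, -, -⟩ := hS
  suffices key : ∀ p ∈ N.places, ¬ Relation.TransGen (N.EdgeIn S) p p by
    intro h
    obtain ⟨y, hxy, hyx⟩ := Relation.TransGen.head'_iff.mp h
    rcases N.edges _ _ hxy.2.2 with hP | hP
    · exact key x hP.1 h
    · exact key y hP.2 (Relation.TransGen.tail' hyx hxy)
  intro p hp hpp
  set Z := N.places.filter fun q => Relation.TransGen (N.EdgeIn S) q q with hZ
  have hZS : ∀ q ∈ Z, q ∈ S := by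
    intro q hq
    obtain ⟨y, hy, -⟩ := Relation.TransGen.head'_iff.mp (Finset.mem_filter.mp hq).2
    exact hy.1
  have hsiph : N.IsSiphon Z := by
    refine ⟨Finset.filter_subset _ _, fun q hq t htq => ?_⟩
    obtain ⟨hqP, hqq⟩ := Finset.mem_filter.mp hq
    obtain ⟨s, hqs, hsq⟩ := Relation.TransGen.tail'_iff.mp hqq
    obtain rfl : s = t := (htnet q (hZS q hq) hqP).1.unique ⟨hsq.1, hsq.2.2⟩
      ⟨hbord q (hZS q hq) hqP t (Or.inl htq), htq⟩
    have hsT := mem_transitions_of_edge' hqP htq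
    rcases hqs.cases_tail with rfl | ⟨y, hqy, hys⟩
    · exact absurd hsT (Finset.disjoint_left.mp N.disj hqP)
    · exact ⟨y, Finset.mem_filter.mpr ⟨mem_places_of_edge hsT hys.2.2,
        (Relation.TransGen.single hys).trans (Relation.TransGen.head' hsq hqy)⟩, hys.2.2⟩
  have hpZ : p ∈ Z := Finset.mem_filter.mpr ⟨hp, hpp⟩
  obtain ⟨y, hpy, -⟩ := Relation.TransGen.head'_iff.mp hpp
  obtain ⟨Q, hQZ, -, q, hq, hMq⟩ := exists_marked_trap hfc hlive hsiph ⟨p, hpZ, hpy.2.2⟩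
  exact hMq (hM q (hsiph.1 (hQZ hq)) (hZS q (hQZ hq)))

/-- `L` is a directed chain in `S` starting at `x`, leaving `S` towards `q` at its end. -/
structure IsExitChain (N : Net α) (S : Finset α) (x q : α) (L : Set α) : Prop where
  start_mem : x ∈ L
  subset : ∀ z ∈ L, z ∈ S
  reach : ∀ z ∈ L, Relation.ReflTransGen (N.EdgeIn S) x z
  comparable : ∀ y ∈ L, ∀ z ∈ L, Relation.ReflTransGen (N.EdgeIn S) y z ∨
    Relation.ReflTransGen (N.EdgeIn S) z y
  next : ∀ z ∈ L, (z ∈ N.transitions ∧ N.F z q) ∨ ∃ y ∈ L, N.F z y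

theorem IsExitChain.insert {S : Finset α} {x y q : α} {L : Set α}
    (h : N.IsExitChain S y q L) (hxy : N.EdgeIn S x y) :
    N.IsExitChain S x q (Insert.insert x L) := by
  have hreach : ∀ z ∈ Insert.insert x L, Relation.ReflTransGen (N.EdgeIn S) x z := by
    rintro z (rfl | hz)
    · exact .refl
    · exact .head hxy (h.reach z hz)
  refine ⟨Or.inl rfl, ?_, hreach, ?_, ?_⟩
  · rintro z (rfl | hz)
    · exact hxy.1
    · exact h.subset z hz
  · rintro a (rfl | ha) b hb
    · exact Or.inl (hreach b hb)
    · rcases hb with rfl | hb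
      · exact Or.inr (hreach a (Or.inr ha))
      · exact h.comparable a ha b hb
  · rintro z (rfl | hz)
    · exact Or.inr ⟨y, Or.inr h.start_mem, hxy.2.2⟩
    · exact (h.next z hz).imp_right fun ⟨y, hy, hzy⟩ => ⟨y, Or.inr hy, hzy⟩

theorem wellFounded_swap_edgeIn {S : Finset α}
    (hacyc : ∀ x, ¬ Relation.TransGen (N.EdgeIn S) x x) :
    WellFounded (Function.swap (N.EdgeIn S)) := by
  have hS : (S : Set α).WellFoundedOn
      (Function.swap (Relation.TransGen (N.EdgeIn S))) := by
    have : IsStrictOrder α (Function.swap (Relation.TransGen (N.EdgeIn S))) :=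
      { irrefl := hacyc, trans := fun a b c h h' => h'.trans h }
    exact S.finite_toSet.wellFoundedOn
  rw [Set.wellFoundedOn_iff] at hS
  exact Subrelation.wf (fun {a b} h => ⟨.single h, h.2.1, h.1⟩) hS

/-- In an acyclic CP-subnet a node that is a place or has a pre-place starts an exit
chain. -/
theorem IsCPSubnet.exists_exitChain [DecidableEq α] {S : Finset α} (hS : N.IsCPSubnet S)
    (hacyc : ∀ x, ¬ Relation.TransGen (N.EdgeIn S) x x)
    (hpost : ∀ t ∈ N.transitions, ∀ p, N.F p t → ∃ q, N.F t q) (x : α) (hxS : x ∈ S)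
    (hx : x ∈ N.places ∨ ∃ p, N.F p x) :
    ∃ q L, q ∈ N.places ∧ q ∉ S ∧ N.IsExitChain S x q L := by
  obtain ⟨-, hSN, -, hbord, htnet, -, -⟩ := hS
  induction x using (wellFounded_swap_edgeIn hacyc).induction with
  | _ x ih =>
    by_cases hsucc : ∃ y, N.EdgeIn S x y
    · obtain ⟨y, hxy⟩ := hsucc
      obtain ⟨q, L, hq, hqS, hL⟩ := ih y hxy hxy.2.1 (Or.inr ⟨x, hxy.2.2⟩)
      exact ⟨q, _, hq, hqS, hL.insert hxy⟩
    have hxP : x ∉ N.places := fun hxP => by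
      obtain ⟨t, ht, -⟩ := (htnet x hxS hxP).2
      exact hsucc ⟨t, hxS, ht⟩
    have hxT : x ∈ N.transitions :=
      (Finset.mem_union.mp (hSN hxS)).resolve_left hxP
    obtain ⟨p, hp⟩ := hx.resolve_left hxP
    obtain ⟨q, hq⟩ := hpost x hxT p hp
    refine ⟨q, {x}, mem_places_of_edge' hxT hq, fun h => hsucc ⟨q, hxS, h, hq⟩, rfl, ?_, ?_,
      ?_, ?_⟩
    · rintro z rfl
      exact hxS
    · rintro z rfl
      exact .refl
    · rintro y rfl z rfl
      exact Or.inl .refl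
    · rintro z rfl
      exact Or.inl ⟨hxT, hq⟩

theorem IsCPSubnet.exists_exitChain_of_isChain [DecidableEq α] {S : Finset α} (hS : N.IsCPSubnet S)
    (hacyc : ∀ x, ¬ Relation.TransGen (N.EdgeIn S) x x)
    (hpost : ∀ t ∈ N.transitions, ∀ p, N.F p t → ∃ q, N.F t q) (δ : List α) (x : α)
    (hδS : ∀ z ∈ x :: δ, z ∈ S) (hδ : (x :: δ).IsChain N.F)
    (hx : δ = [] → x ∈ N.places ∨ ∃ p, N.F p x) :
    ∃ q L, q ∈ N.places ∧ q ∉ S ∧ N.IsExitChain S x q L ∧ ∀ z ∈ x :: δ, z ∈ L := by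
  induction δ generalizing x with
  | nil =>
    obtain ⟨q, L, hq, hqS, hL⟩ :=
      hS.exists_exitChain hacyc hpost x (hδS x (by simp)) (hx rfl)
    exact ⟨q, L, hq, hqS, hL, by simpa using hL.start_mem⟩
  | cons y δ ih =>
    rw [List.isChain_cons_cons] at hδ
    obtain ⟨q, L, hq, hqS, hL, hδL⟩ := ih y (fun z hz => hδS z (List.mem_cons_of_mem _ hz))
      hδ.2 (fun _ => Or.inr ⟨x, hδ.1⟩)
    refine ⟨q, _, hq, hqS, hL.insert ⟨hδS x (by simp), hδS y (by simp), hδ.1⟩, ?_⟩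
    intro z hz
    rcases List.mem_cons.mp hz with rfl | hz
    · exact Or.inl rfl
    · exact Or.inr (hδL z hz)

/-- Reachability from `a` admits a rank decreasing along suitable predecessors. -/
theorem _root_.Relation.ReflTransGen.exists_rank {β : Type*} (r : β → β → Prop) (a : β) :
    ∃ d : β → ℕ, ∀ z, Relation.ReflTransGen r a z → z ≠ a → ∃ y, r y z ∧
      Relation.ReflTransGen r a y ∧ d y < d z := by
  let B : ℕ → Set β := fun n => Nat.rec {a} (fun _ X => {z | ∃ y ∈ X, r y z}) n
  have hB : ∀ n, ∀ z ∈ B n, Relation.ReflTransGen r a z := by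
    intro n
    induction n with
    | zero =>
      intro z (hz : z = a)
      rw [hz]
    | succ n ih =>
      rintro z ⟨y, hy, hyz⟩
      exact (ih y hy).tail hyz
  have hB' : ∀ z, Relation.ReflTransGen r a z → ∃ n, z ∈ B n := by
    intro z hz
    induction hz with
    | refl => exact ⟨0, rfl⟩
    | tail _ hyz ih =>
      obtain ⟨n, hn⟩ := ih
      exact ⟨n + 1, _, hn, hyz⟩
  refine ⟨fun z => sInf {n | z ∈ B n}, fun z hz hza => ?_⟩
  have hmem : z ∈ B (sInf {n | z ∈ B n}) := Nat.sInf_mem (hB' z hz)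
  cases hn : sInf {n | z ∈ B n} with
  | zero =>
    rw [hn] at hmem
    exact absurd hmem hza
  | succ n =>
    rw [hn] at hmem
    obtain ⟨y, hy, hyz⟩ := hmem
    refine ⟨y, hyz, hB n y hy, ?_⟩
    simp only [hn]
    exact Nat.lt_succ_of_le (Nat.sInf_le hy)

/-- A trap meeting every pre-set in at most one place is never decreased. -/
theorem IsTrap.gain_nonneg {Q : Finset α} (hQ : N.IsTrap Q)
    (huniq : ∀ t, ∀ p ∈ Q, ∀ q ∈ Q, N.F p t → N.F q t → p = q) (t : α) :
    0 ≤ N.gain Q t := by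
  rw [gain, Finset.sum_sub_distrib, Finset.sum_boole, Finset.sum_boole, sub_nonneg,
    Nat.cast_le]
  rcases (Q.filter (N.F · t)).eq_empty_or_nonempty with h | ⟨p, hp⟩
  · simp [h]
  · obtain ⟨hpQ, hpt⟩ := Finset.mem_filter.mp hp
    obtain ⟨q, hq, htq⟩ := hQ p hpQ t hpt
    calc _ ≤ 1 := Finset.card_le_one.mpr fun a ha b hb => by
            rw [Finset.mem_filter] at ha hb
            exact huniq t a ha.1 b hb.1 ha.2 hb.2
      _ ≤ _ := Finset.card_pos.mpr ⟨q, Finset.mem_filter.mpr ⟨hq, htq⟩⟩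

theorem exists_pre_of_gain_eq_zero {Q : Finset α} (h : N.gain Q t = 0) {q : α} (hq : q ∈ Q)
    (htq : N.F t q) : ∃ p ∈ Q, N.F p t := by
  by_contra! hno
  rw [gain, Finset.sum_sub_distrib, Finset.sum_boole, Finset.sum_boole,
    Finset.filter_false_of_mem hno] at h
  have := Finset.card_pos.mpr ⟨q, Finset.mem_filter.mpr ⟨hq, htq⟩⟩
  simp at h
  exact h hq htq

/-- A perpetual system reaches one fixed marking from everywhere. -/
theorem Perpetual.exists_home [DecidableEq α] {μ₀ : α → ℕ} {cl : Set α} (h : N.Perpetual μ₀ cl) :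
    ∃ M, N.Reach μ₀ M ∧ N.MarkingEq M (N.clusterMarking cl) ∧
      ∀ μ, N.Reach μ₀ μ → N.Reach μ M := by
  obtain ⟨M, hM, hMcl⟩ := h.2.2.2 μ₀ (Reach.refl μ₀)
  refine ⟨M, hM, hMcl, fun μ hμ => ?_⟩
  obtain ⟨ν, hν, hνcl⟩ := h.2.2.2 μ hμ
  have : ν = M := by
    funext x
    by_cases hx : x ∈ N.places
    · rw [hνcl x hx, hMcl x hx]
    · rw [(hμ.trans hν).eq_of_notMem_places hx, hM.eq_of_notMem_places hx]
  exact this ▸ hν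

theorem IsCluster.edge_of_mem [DecidableEq α] (hfc : N.FreeChoice) {cl : Set α}
    (hcl : N.IsCluster cl) {p q : α} (hp : p ∈ N.places) (hq : q ∈ N.places) (hpcl : p ∈ cl)
    (hqcl : q ∈ cl) (hpt : N.F p t) : N.F q t := by
  rcases hcl.subset hfc hp hpcl hpt hqcl with h | h
  · exact h
  · exact absurd h.1 (Finset.disjoint_left.mp N.disj hq)

/-- The places of an exit chain of an adapted CP-subnet lie in a conserved set of places
carrying at most one token. -/
theorem IsExitChain.exists_conserved [DecidableEq α] (hfc : N.FreeChoice)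
    (hlive : N.Live M) (hret : ∀ μ, N.Reach M μ → N.Reach μ M) (hb : N.Bounded M)
    {cl : Set α} (hcl : N.IsCluster cl) (hM : N.MarkingEq M (N.clusterMarking cl))
    {S : Finset α} (hS : N.IsCPSubnet S) (had : ¬ cl ⊆ (S : Set α))
    (hacyc : ∀ x, ¬ Relation.TransGen (N.EdgeIn S) x x) {x q : α} {L : Set α}
    (hq : q ∈ N.places) (hqS : q ∉ S) (hL : N.IsExitChain S x q L)
    (hplace : ∃ p ∈ L, p ∈ N.places) :
    ∃ Q : Finset α, (∀ t ∈ N.transitions, N.gain Q t = 0) ∧ ∑ p ∈ Q, M p ≤ 1 ∧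
      ∀ p ∈ L, p ∈ N.places → p ∈ Q := by
  have hnotT : ∀ p ∈ N.places, p ∉ N.transitions :=
    fun p hp => Finset.disjoint_left.mp N.disj hp
  obtain ⟨d, hd⟩ := Relation.ReflTransGen.exists_rank
    (fun a b => a ∈ N.nodes \ S ∧ b ∈ N.nodes \ S ∧ N.F a b) q
  set f : α → ℕ := fun p => if p ∈ L then 0 else d p + 1 with hf
  have hmin (X : Set α) : ∃ p, X.Nonempty → p ∈ X ∧ ∀ y ∈ X, f p ≤ f y := by
    by_cases hX : X.Nonempty
    · exact ⟨Function.argminOn f X hX, fun _ =>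
        ⟨Function.argminOn_mem f X hX, fun y hy => Function.argminOn_le f X hy⟩⟩
    · exact ⟨q, fun h => absurd h hX⟩
  choose s hs using hmin
  have hsmem {p t : α} (h : N.F p t) : N.F (s (N.pre t)) t := (hs (N.pre t) ⟨p, h⟩).1
  have hsle {p t : α} (h : N.F p t) : f (s (N.pre t)) ≤ f p := (hs (N.pre t) ⟨p, h⟩).2 p h
  set R := N.places.filter fun p => ∃ t, N.F p t ∧ s (N.pre t) = p with hR
  have hRsel {p t : α} (hp : p ∈ R) (hpt : N.F p t) : p = s (N.pre t) := by
    obtain ⟨hpP, u, hpu, hu⟩ := Finset.mem_filter.mp hp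
    rw [hfc.pre_eq hpP hpt hpu, hu]
  have hselR {p t : α} (htT : t ∈ N.transitions) (hpt : N.F p t) : s (N.pre t) ∈ R :=
    Finset.mem_filter.mpr ⟨mem_places_of_edge htT (hsmem hpt), t, hsmem hpt, rfl⟩
  have hsiph : N.IsSiphon R := by
    refine ⟨Finset.filter_subset _ _, fun p hp t htp => ?_⟩
    have htT := mem_transitions_of_edge' (Finset.mem_filter.mp hp).1 htp
    obtain ⟨y, hy⟩ := exists_pre hb htT htp
    exact ⟨_, hselR htT hy, hsmem hy⟩
  have hpostS {p : α} (hp : p ∈ N.places) (hpS : p ∈ S) : ∃ t ∈ S, N.F p t :=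
    (hS.2.2.2.2.1 p hpS hp).2.exists.imp fun _ h => h
  obtain ⟨p, hpL, hpP⟩ := hplace
  obtain ⟨u, -, hpu⟩ := hpostS hpP (hL.subset p hpL)
  obtain ⟨Q, hQR, hQ, p₀, hp₀, hMp₀⟩ := exists_marked_trap hfc hlive hsiph
    ⟨_, hselR (mem_transitions_of_edge hpP hpu) hpu, hsmem hpu⟩
  have hQP : ∀ p ∈ Q, p ∈ N.places := fun p hp => hsiph.1 (hQR hp)
  have huniq : ∀ t, ∀ a ∈ Q, ∀ b ∈ Q, N.F a t → N.F b t → a = b := fun t a ha b hb hat hbt =>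
    (hRsel (hQR ha) hat).trans (hRsel (hQR hb) hbt).symm
  have hgain := gain_eq_zero hlive hret fun t _ => hQ.gain_nonneg huniq t
  have hback {t y : α} (hy : y ∈ Q) (hty : N.F t y) : s (N.pre t) ∈ Q := by
    obtain ⟨a, ha, hat⟩ := exists_pre_of_gain_eq_zero
      (hgain t (mem_transitions_of_edge' (hQP y hy) hty)) hy hty
    exact hRsel (hQR ha) hat ▸ ha
  have hbord := hS.2.2.2.1
  have hqQ : q ∈ Q := by
    have hmemC {a : α} (ha : a ∈ N.places) (haS : a ∉ S) : a ∈ N.nodes \ S :=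
      Finset.mem_sdiff.mpr ⟨Finset.mem_union_left _ ha, haS⟩
    have key (n : ℕ) : ∀ a ∈ Q, a ∉ S → d a = n → q ∈ Q := by
      induction n using Nat.strong_induction_on with
      | _ n ih =>
        intro a ha haS han
        by_cases haq : a = q
        · exact haq ▸ ha
        have haP := hQP a ha
        obtain ⟨t, ⟨htC, -, hta⟩, hqt, hdt⟩ :=
          hd a (hS.2.2.2.2.2.2 q (hmemC hq hqS) a (hmemC haP haS)) haq
        have htT := mem_transitions_of_edge' haP hta
        obtain ⟨b, ⟨hbC, -, hbt⟩, -, hdb⟩ := hd t hqt fun h => hnotT q hq (h ▸ htT)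
        have hsS : s (N.pre t) ∉ S := fun h => (Finset.mem_sdiff.mp htC).2
          (hbord _ h (mem_places_of_edge htT (hsmem hbt)) t (Or.inr (hsmem hbt)))
        have hle := hsle hbt
        simp only [hf, if_neg fun h => hsS (hL.subset _ h),
          if_neg fun h => (Finset.mem_sdiff.mp hbC).2 (hL.subset _ h)] at hle
        exact ih _ (by omega) _ (hback ha hta) hsS rfl
    refine key _ p₀ hp₀ (fun h => ?_) rfl
    rw [hM p₀ (hQP p₀ hp₀), clusterMarking, ne_eq, ite_eq_right_iff] at hMp₀
    push Not at hMp₀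
    exact hS.notMem_cluster hfc hcl had (hQP p₀ hp₀) h hMp₀.1.1
  refine ⟨Q, hgain, ?_, ?_⟩
  · have h1 : ∑ p ∈ Q, M p = (Q.filter (· ∈ cl)).card := by
      rw [Finset.card_filter]
      refine Finset.sum_congr rfl fun p hp => ?_
      rw [hM p (hQP p hp), clusterMarking]
      simp [hQP p hp]
    rw [h1, Finset.card_le_one]
    intro a ha b hb
    rw [Finset.mem_filter] at ha hb
    obtain ⟨-, t, hat, -⟩ := Finset.mem_filter.mp (hQR ha.1)
    exact huniq t a ha.1 b hb.1 hat
      (hcl.edge_of_mem hfc (hQP a ha.1) (hQP b hb.1) ha.2 hb.2 hat)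
  · suffices key : ∀ z ∈ L, (z ∈ N.places → z ∈ Q) ∧
        (z ∈ N.transitions → ∃ y ∈ Q, N.F z y) from fun z hz => (key z hz).1
    intro z
    induction z using (wellFounded_swap_edgeIn hacyc).induction with
    | _ z ih =>
      intro hz
      refine ⟨fun hzP => ?_, fun hzT => ?_⟩
      · obtain ⟨y, hy, hzy⟩ := (hL.next z hz).resolve_left fun h => hnotT z hzP h.1
        have hyS := hL.subset y hy
        have hyT := mem_transitions_of_edge hzP hzy
        obtain ⟨b, hb, hyb⟩ := (ih y ⟨hL.subset z hz, hyS, hzy⟩ hy).2 hyT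
        have hsL : s (N.pre y) ∈ L := by
          by_contra hno
          have hle := hsle hzy
          simp [hf, hno, hz] at hle
        have heq : ∀ a ∈ L, ∀ c ∈ L, N.F a y → N.F c y →
            Relation.ReflTransGen (N.EdgeIn S) a c → a = c := by
          intro a ha c hc hay hcy hac
          rcases hac.cases_head with h | ⟨w, haw, hwc⟩
          · exact h
          · obtain rfl : w = y := (hS.2.2.2.2.1 a (hL.subset a ha)
              (mem_places_of_edge hyT hay)).2.unique haw.2 ⟨hyS, hay⟩
            exact absurd (Relation.TransGen.tail' hwc ⟨hL.subset c hc, hyS, hcy⟩) (hacyc w)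
        have : s (N.pre y) = z := by
          rcases hL.comparable _ hsL z hz with h | h
          · exact heq _ hsL z hz (hsmem hzy) hzy h
          · exact (heq z hz _ hsL hzy (hsmem hzy) h).symm
        exact this ▸ hback hb hyb
      · rcases hL.next z hz with h | ⟨y, hy, hzy⟩
        · exact ⟨q, hqQ, h.2⟩
        · exact ⟨y, (ih y ⟨hL.subset z hz, hL.subset y hy, hzy⟩ hy).1
            (mem_places_of_edge' hzT hzy), hzy⟩

end Net

/-- **Safety of paths in adapted CP-subnets.** Let `(N, μ₀)` be a perpetual
free-choice system with regeneration cluster `cl`, let `S` span a `cl`-adapted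
CP-subnet, and let `μ` be a reachable marking. Then every path contained in
the subnet has token count `‖μ‖_δ ≤ 1`. -/
theorem adapted_cpSubnet_path_safe
    {α : Type*} [DecidableEq α] (N : Net α) (μ₀ : α → ℕ) (cl : Set α)
    (hfc : N.FreeChoice) (hperp : N.Perpetual μ₀ cl)
    (S : Finset α) (hS : N.IsCPSubnet S) (had : ¬ cl ⊆ (S : Set α))
    (μ : α → ℕ) (hμ : N.Reach μ₀ μ)
    (δ : List α) (hδ : N.IsPath δ) (hδS : ∀ x ∈ δ, x ∈ S) :
    N.tokenCount μ δ.toFinset ≤ 1 := by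
  obtain ⟨M, hM₀, hM, hhome⟩ := hperp.exists_home
  have hcl := hperp.2.2.1
  have hlive := hperp.1.of_reach hM₀
  have hret : ∀ ν, N.Reach M ν → N.Reach ν M := fun ν h => hhome ν (hM₀.trans h)
  have hb : N.Bounded M := hperp.2.1.imp fun K hK ν h => hK ν (hM₀.trans h)
  have hacyc := hS.acyclic hfc hlive fun p hp hpS => by
    rw [hM p hp, Net.clusterMarking, if_neg fun h => hS.notMem_cluster hfc hcl had hp hpS h.1]
  unfold Net.tokenCount
  by_cases hplace : ∃ p ∈ δ, p ∈ N.places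
  · cases δ with
    | nil => simp at hplace
    | cons x δ =>
      obtain ⟨q, L, hq, hqS, hL, hδL⟩ := hS.exists_exitChain_of_isChain hacyc
        (fun t ht p hp => Net.exists_post hlive hret hb ht hp) δ x hδS hδ.2.2
        (by rintro rfl; exact Or.inl (by simpa using hplace))
      obtain ⟨Q, hQ, hQM, hLQ⟩ := hL.exists_conserved hfc hlive hret hb hcl hM hS had hacyc
        hq hqS (hplace.imp fun p hp => ⟨hδL p hp.1, hp.2⟩)
      calc _ ≤ ∑ p ∈ Q, μ p := Finset.sum_le_sum_of_subset fun p hp => by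
              rw [Finset.mem_inter, List.mem_toFinset] at hp
              exact hLQ p (hδL p hp.1) hp.2
        _ = ∑ p ∈ Q, M p := ((hhome μ hμ).sum_eq_of_gain_eq_zero hQ).symm
        _ ≤ 1 := hQM
  · rw [Finset.sum_eq_zero]
    · exact zero_le_one
    · intro p hp
      rw [Finset.mem_inter, List.mem_toFinset] at hp
      exact absurd ⟨p, hp⟩ hplace
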